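/- arXiv:2308.06171 — 3 statements merged into one kernel-verified Lean document; each statement's English description precedes it below -/
import Mathlib

section
/- For every integer n > d and every real polynomial f with deg f ≤ n−d−1, one has ∫ S_n(x) f(x) ρ̂(x) dμ(x) = 0; that is, S_n is quasi-orthogonal of order d with respect to the modified measure ρ̂ dμ. -/
open Polynomial MeasureTheory Finset

noncomputable section

/-- The `k`-th derivative of a real polynomial. -/
def iterDeriv (k : ℕ) (f : Polynomial ℝ) : Polynomial ℝ := Polynomial.derivative^[k] f

/-- The support of a Borel measure on `ℝ`. -/
def measSupport (μ : Measure ℝ) : Set ℝ :=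
  {x | ∀ ε > 0, 0 < μ (Set.Ioo (x - ε) (x + ε))}

/-- The discrete Sobolev-type inner product
`⟨f,g⟩_S = ∫ f g dμ + ∑_{j=1}^N ∑_{k=0}^{d_j} λ_{j,k} f^{(k)}(c_j) g^{(k)}(c_j)`. -/
def sobolevIP (μ : Measure ℝ) {N : ℕ} (c : Fin N → ℝ) (dd : Fin N → ℕ)
    (lam : Fin N → ℕ → ℝ) (f g : Polynomial ℝ) : ℝ :=
  (∫ x, f.eval x * g.eval x ∂μ) +
    ∑ j : Fin N, ∑ k ∈ Finset.range (dd j + 1),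
      lam j k * (iterDeriv k f).eval (c j) * (iterDeriv k g).eval (c j)

/-- The polynomial `ρ̂(x) = ∏_{c_j ≤ a} (x - c_j)^{d_j+1} ∏_{c_j ≥ b} (c_j - x)^{d_j+1}`,
for points `c_j` lying outside `(a,b)`. -/
def rhoHat {N : ℕ} (a : ℝ) (c : Fin N → ℝ) (dd : Fin N → ℕ) : Polynomial ℝ :=
  ∏ j : Fin N,
    if c j ≤ a then (X - Polynomial.C (c j)) ^ (dd j + 1)
    else (Polynomial.C (c j) - X) ^ (dd j + 1)

/-- Polynomials are integrable against a measure with finite moments. -/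
lemma integrable_eval_of_moments {μ : Measure ℝ}
    (hmom : ∀ m : ℕ, Integrable (fun x => x ^ m) μ) (p : Polynomial ℝ) :
    Integrable (fun x => p.eval x) μ := by
  simp only [Polynomial.eval_eq_sum_range]
  exact integrable_finsetSum _ fun i _ => (hmom i).const_mul _

section SobolevIP

variable {μ : Measure ℝ} {N : ℕ} (c : Fin N → ℝ) (dd : Fin N → ℕ) (lam : Fin N → ℕ → ℝ)

lemma sobolevIP_add_left (hmom : ∀ m : ℕ, Integrable (fun x => x ^ m) μ)
    (f g h : Polynomial ℝ) :
    sobolevIP μ c dd lam (f + g) h = sobolevIP μ c dd lam f h + sobolevIP μ c dd lam g h := by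
  have hint (p : Polynomial ℝ) : Integrable (fun x => p.eval x * h.eval x) μ := by
    simpa only [Polynomial.eval_mul] using integrable_eval_of_moments hmom (p * h)
  simp only [sobolevIP, iterDeriv, iterate_map_add, Polynomial.eval_add,
    add_mul, mul_add, Finset.sum_add_distrib, integral_add (hint f) (hint g)]
  ring

lemma sobolevIP_C_mul_left (r : ℝ) (f h : Polynomial ℝ) :
    sobolevIP μ c dd lam (C r * f) h = r * sobolevIP μ c dd lam f h := by
  simp only [sobolevIP, iterDeriv, Polynomial.iterate_derivative_C_mul, Polynomial.eval_mul,
    Polynomial.eval_C, mul_assoc, mul_left_comm _ r, integral_const_mul, mul_add, Finset.mul_sum]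

lemma sobolevIP_eq_zero_of_natDegree_lt (hmom : ∀ m : ℕ, Integrable (fun x => x ^ m) μ)
    {n : ℕ} {S : Polynomial ℝ} (hS : ∀ m < n, sobolevIP μ c dd lam (X ^ m) S = 0)
    {g : Polynomial ℝ} (hg : g.natDegree < n) : sobolevIP μ c dd lam g S = 0 := by
  have hzero : sobolevIP μ c dd lam 0 S = 0 := by simp [sobolevIP, iterDeriv]
  rw [g.as_sum_range_C_mul_X_pow' hg]
  refine Finset.sum_induction _ (fun p => sobolevIP μ c dd lam p S = 0) ?_ hzero ?_
  · intro p q hp hq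
    rw [sobolevIP_add_left c dd lam hmom, hp, hq, add_zero]
  · intro i hi
    rw [sobolevIP_C_mul_left, hS i (Finset.mem_range.mp hi), mul_zero]

end SobolevIP

lemma natDegree_rhoHat_le {N : ℕ} (a : ℝ) (c : Fin N → ℝ) (dd : Fin N → ℕ) :
    (rhoHat a c dd).natDegree ≤ ∑ j, (dd j + 1) := by
  refine (Polynomial.natDegree_prod_le _ _).trans (Finset.sum_le_sum fun j _ => ?_)
  split_ifs
  · simp
  · have h : (C (c j) - X : Polynomial ℝ).natDegree ≤ 1 := by compute_degree
    simpa using Polynomial.natDegree_pow_le_of_le (dd j + 1) h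

lemma X_sub_C_pow_dvd_rhoHat {N : ℕ} (a : ℝ) (c : Fin N → ℝ) (dd : Fin N → ℕ) (j : Fin N) :
    (X - C (c j)) ^ (dd j + 1) ∣ rhoHat a c dd := by
  refine dvd_trans ?_ (Finset.dvd_prod_of_mem _ (Finset.mem_univ j))
  split_ifs
  · exact dvd_rfl
  · exact pow_dvd_pow_of_dvd ((dvd_neg.mpr dvd_rfl).trans (neg_sub _ _).dvd) _

lemma eval_iterDeriv_eq_zero_of_pow_dvd {p : Polynomial ℝ} {r : ℝ} {m k : ℕ}
    (hp : (X - C r) ^ m ∣ p) (hk : k < m) : (iterDeriv k p).eval r = 0 := by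
  have h := Polynomial.pow_sub_dvd_iterate_derivative_of_pow_dvd k hp
  exact Polynomial.dvd_iff_isRoot.mp ((dvd_pow_self _ (by omega)).trans h)

theorem stmt1 (μ : Measure ℝ) [IsFiniteMeasure μ]
    (hmom : ∀ m : ℕ, Integrable (fun x => x ^ m) μ)
    (hsupp : (measSupport μ).Infinite)
    (a b : ℝ) (hab : Set.Ioo a b = interior (convexHull ℝ (measSupport μ)))
    (N : ℕ) (hN : 1 ≤ N)
    (c : Fin N → ℝ) (hc : Function.Injective c) (hcout : ∀ j, c j ∉ Set.Ioo a b)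
    (dd : Fin N → ℕ) (hdd : Monotone dd)
    (lam : Fin N → ℕ → ℝ) (hlam : ∀ j k, 0 ≤ lam j k) (hlamd : ∀ j, 0 < lam j (dd j))
    (d : ℕ) (hd : d = ∑ j, (dd j + 1))
    (n : ℕ) (hn : d < n)
    (Sn : Polynomial ℝ) (hSm : Sn.Monic) (hSd : Sn.natDegree = n)
    (hSo : ∀ m < n, sobolevIP μ c dd lam (X ^ m) Sn = 0)
    (f : Polynomial ℝ) (hf : f.natDegree ≤ n - d - 1) :
    ∫ x, Sn.eval x * f.eval x * (rhoHat a c dd).eval x ∂μ = 0 := by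
  have hdeg : (f * rhoHat a c dd).natDegree < n := by
    have h₁ := Polynomial.natDegree_mul_le (p := f) (q := rhoHat a c dd)
    have h₂ := natDegree_rhoHat_le a c dd
    omega
  have hzero := sobolevIP_eq_zero_of_natDegree_lt c dd lam hmom hSo hdeg
  have hdisc : ∑ j : Fin N, ∑ k ∈ Finset.range (dd j + 1),
      lam j k * (iterDeriv k (f * rhoHat a c dd)).eval (c j) * (iterDeriv k Sn).eval (c j) = 0 := by
    refine Finset.sum_eq_zero fun j _ => Finset.sum_eq_zero fun k hk => ?_
    rw [eval_iterDeriv_eq_zero_of_pow_dvd ((X_sub_C_pow_dvd_rhoHat a c dd j).mul_left f)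
      (Finset.mem_range.mp hk), mul_zero, zero_mul]
  rw [sobolevIP, hdisc, add_zero] at hzero
  rw [← hzero]
  congr 1 with x
  rw [Polynomial.eval_mul]
  ring
end
end

section
/- For all integers n ≥ 1 and k ≥ 0 and all real x ≠ y: Σ_{i=0}^{n−1} P_i(x) P_i^{(k)}(y) / ‖P_i‖_μ² = k! · ( Q_k(x,y;P_{n−1}) P_n(x) − Q_k(x,y;P_n) P_{n−1}(x) ) / ( ‖P_{n−1}‖_μ² (x−y)^{k+1} ). -/
open Polynomial MeasureTheory Finset

noncomputable section

/-- A polynomial of degree less than `m` is a combination of the first `m` terms of a sequence of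
monic polynomials `P j` of degree `j`. -/
lemma exists_eq_sum_of_degree_lt {P : ℕ → ℝ[X]} (hPm : ∀ m, (P m).Monic)
    (hPd : ∀ m, (P m).natDegree = m) (m : ℕ) (f : ℝ[X]) (hf : f.degree < m) :
    ∃ c : ℕ → ℝ, f = ∑ j ∈ range m, C (c j) * P j := by
  induction m generalizing f with
  | zero => exact ⟨0, by simpa [Polynomial.degree_lt_iff_coeff_zero, Polynomial.ext_iff] using hf⟩
  | succ m ih =>
    obtain ⟨c, hc⟩ := ih (f - C (f.coeff m) * P m) (by
      rw [degree_lt_iff_coeff_zero] at hf ⊢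
      intro j hj
      rcases hj.eq_or_lt with rfl | hlt
      · have : (P m).coeff m = 1 := by simpa [hPd m] using (hPm m).coeff_natDegree
        simp [this]
      · have : (P m).coeff j = 0 := coeff_eq_zero_of_natDegree_lt (by rw [hPd]; exact hlt)
        simp [this, hf j hlt])
    refine ⟨Function.update c m (f.coeff m), ?_⟩
    rw [sum_range_succ, Function.update_self,
      sum_congr rfl (g := fun j => C (c j) * P j) fun j hj => by
        rw [Function.update_of_ne (mem_range.1 hj).ne], ← hc, sub_add_cancel]

section Orthogonal

variable {L : ℝ[X] →ₗ[ℝ] ℝ} {P : ℕ → ℝ[X]} {h : ℕ → ℝ}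

lemma apply_sum_mul_of_orthogonal (hPo : ∀ m l, m ≠ l → L (P m * P l) = 0)
    (hh : ∀ m, h m = L (P m * P m)) (c : ℕ → ℝ) (m j : ℕ) :
    L ((∑ i ∈ range m, C (c i) * P i) * P j) = if j < m then c j * h j else 0 := by
  have key : ∀ i, L (C (c i) * P i * P j) = if i = j then c j * h j else 0 := by
    intro i
    rw [mul_assoc, ← smul_eq_C_mul, map_smul, smul_eq_mul]
    split_ifs with hij
    · rw [hij, hh]
    · rw [hPo i j hij, mul_zero]
  simp [sum_mul, map_sum, key]

lemma apply_mul_eq_zero_of_degree_lt (hPm : ∀ m, (P m).Monic) (hPd : ∀ m, (P m).natDegree = m)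
    (hPo : ∀ m l, m ≠ l → L (P m * P l) = 0) (f : ℝ[X]) (m : ℕ) (hf : f.degree < m) :
    L (f * P m) = 0 := by
  obtain ⟨c, rfl⟩ := exists_eq_sum_of_degree_lt hPm hPd m f hf
  simpa using apply_sum_mul_of_orthogonal hPo (fun _ => rfl) c m m

lemma degree_X_mul_sub_lt (hPm : ∀ m, (P m).Monic) (hPd : ∀ m, (P m).natDegree = m) (m : ℕ) :
    (X * P m - P (m + 1)).degree < ((m + 1 : ℕ) : WithBot ℕ) := by
  have hm : (X * P m).natDegree = m + 1 := by rw [natDegree_X_mul (hPm m).ne_zero, hPd]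
  have hd : (X * P m).degree = ((m + 1 : ℕ) : WithBot ℕ) := by
    rw [degree_eq_natDegree (monic_X.mul (hPm m)).ne_zero, hm]
  have hd' : (P (m + 1)).degree = ((m + 1 : ℕ) : WithBot ℕ) := by
    rw [degree_eq_natDegree (hPm _).ne_zero, hPd]
  rw [← hd]
  exact degree_sub_lt_left (hd.trans hd'.symm) (monic_X.mul (hPm m)).ne_zero
    (by rw [(monic_X.mul (hPm m)).leadingCoeff, (hPm _).leadingCoeff])

/-- The three-term recurrence for monic orthogonal polynomials. -/
lemma exists_three_term_recurrence (hPm : ∀ m, (P m).Monic) (hPd : ∀ m, (P m).natDegree = m)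
    (hPo : ∀ m l, m ≠ l → L (P m * P l) = 0) (hh : ∀ m, h m = L (P m * P m))
    (h0 : ∀ m, h m ≠ 0) (m : ℕ) :
    ∃ a : ℝ, X * P (m + 1) = P (m + 2) + C a * P (m + 1) + C (h (m + 1) / h m) * P m := by
  obtain ⟨c, hc⟩ := exists_eq_sum_of_degree_lt hPm hPd (m + 2) _
    (degree_X_mul_sub_lt hPm hPd (m + 1))
  have key : ∀ j < m + 1, c j * h j = L ((X * P j - P (j + 1)) * P (m + 1))
      + L (P (j + 1) * P (m + 1)) := by
    intro j hj
    have := apply_sum_mul_of_orthogonal hPo hh c (m + 2) j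
    rw [← hc, if_pos (by omega), sub_mul, map_sub, hPo (m + 1 + 1) j (by omega), sub_zero] at this
    rw [← this, ← map_add]
    congr 1
    ring
  have hlow : ∀ j < m, c j = 0 := by
    intro j hj
    have := key j (by omega)
    rw [hPo (j + 1) (m + 1) (by omega), add_zero, apply_mul_eq_zero_of_degree_lt hPm hPd hPo _ _
      ((degree_X_mul_sub_lt hPm hPd j).trans (by exact_mod_cast (by omega : j + 1 < m + 1)))] at this
    exact (mul_eq_zero.1 this).resolve_right (h0 j)
  have hcm : c m = h (m + 1) / h m := by
    rw [eq_div_iff (h0 m), key m (by omega), ← hh,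
      apply_mul_eq_zero_of_degree_lt hPm hPd hPo _ _ (degree_X_mul_sub_lt hPm hPd m), zero_add]
  refine ⟨c (m + 1), ?_⟩
  rw [sum_range_succ, sum_range_succ, sum_eq_zero fun j hj => by
    rw [hlow j (mem_range.1 hj), C_0, zero_mul], hcm] at hc
  linear_combination hc

/-- The Christoffel–Darboux formula. -/
lemma christoffel_darboux (hPm : ∀ m, (P m).Monic) (hPd : ∀ m, (P m).natDegree = m)
    (hPo : ∀ m l, m ≠ l → L (P m * P l) = 0) (hh : ∀ m, h m = L (P m * P m))
    (h0 : ∀ m, h m ≠ 0) (n : ℕ) (x : ℝ) :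
    (C x - X) * ∑ i ∈ range (n + 1), C ((P i).eval x / h i) * P i =
      C ((P (n + 1)).eval x / h n) * P n - C ((P n).eval x / h n) * P (n + 1) := by
  induction n with
  | zero =>
    obtain ⟨c, hc⟩ := exists_eq_sum_of_degree_lt hPm hPd 1 _ (degree_X_mul_sub_lt hPm hPd 0)
    have h1 : P 0 = 1 := (hPm 0).natDegree_eq_zero.1 (hPd 0)
    have hP : P 1 = X - C (c 0) := by
      simp only [h1, zero_add, mul_one, range_one, sum_singleton] at hc
      rw [← hc, sub_sub_cancel]
    simp only [h1, hP, zero_add, range_one, sum_singleton, mul_one, eval_one, eval_sub, eval_X,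
      eval_C, C_sub, div_eq_mul_inv, C_mul, C_1, one_mul]
    ring
  | succ n ih =>
    obtain ⟨a, ha⟩ := exists_three_term_recurrence hPm hPd hPo hh h0 n
    rw [sum_range_succ, mul_add, ih]
    refine Polynomial.funext fun y => ?_
    have hx := congrArg (eval x) ha
    have hy := congrArg (eval y) ha
    simp only [eval_add, eval_sub, eval_mul, eval_X, eval_C] at hx hy ⊢
    have e0 := h0 n
    have e1 := h0 (n + 1)
    field_simp at hx hy ⊢
    linear_combination (P (n + 1)).eval y * hx - (P (n + 1)).eval x * hy

end Orthogonal

/-- The `k`-th Taylor polynomial at `y`, evaluated at `x`, of `(x - X) * g` is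
`g⁽ᵏ⁾(y) (x - y)ᵏ⁺¹ / k!`. -/
lemma sum_taylor_C_sub_X_mul (g : ℝ[X]) (x y : ℝ) (k : ℕ) :
    ∑ ν ∈ range (k + 1), (iterDeriv ν ((C x - X) * g)).eval y * (x - y) ^ ν / ν.factorial =
      (iterDeriv k g).eval y * (x - y) ^ (k + 1) / k.factorial := by
  have step : ∀ k, iterDeriv (k + 1) ((C x - X) * g) =
      (C x - X) * iterDeriv (k + 1) g - C ((k : ℝ) + 1) * iterDeriv k g := by
    intro k
    induction k with
    | zero => simp [iterDeriv]; ring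
    | succ k ih =>
      have hs : ∀ m (f : ℝ[X]), iterDeriv (m + 1) f = derivative (iterDeriv m f) :=
        fun m f => Function.iterate_succ_apply' _ _ _
      rw [hs, ih, hs (k + 1)]
      simp only [derivative_sub, derivative_mul, derivative_C, derivative_X, ← hs]
      push_cast
      simp only [C_add, C_1]
      ring
  induction k with
  | zero => simp [iterDeriv]; ring
  | succ k ih =>
    rw [sum_range_succ, ih, step, Nat.factorial_succ]
    simp only [eval_sub, eval_mul, eval_C, eval_X]
    push_cast
    have := k.factorial_ne_zero
    field_simp
    ring

lemma integrable_polynomial_eval {μ : Measure ℝ} (hmom : ∀ m : ℕ, Integrable (fun x => x ^ m) μ)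
    (f : ℝ[X]) : Integrable (fun x => f.eval x) μ := by
  simp only [eval_eq_sum_range]
  exact integrable_finsetSum _ fun i _ => (hmom i).const_mul _

/-- Integration against a measure with finite moments, as a linear functional on polynomials. -/
def momentFunctional (μ : Measure ℝ) (hmom : ∀ m : ℕ, Integrable (fun x => x ^ m) μ) :
    ℝ[X] →ₗ[ℝ] ℝ where
  toFun f := ∫ x, f.eval x ∂μ
  map_add' f g := by
    simp only [eval_add]
    exact integral_add (integrable_polynomial_eval hmom f) (integrable_polynomial_eval hmom g)
  map_smul' c f := by
    simp only [eval_smul, smul_eq_mul, RingHom.id_apply]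
    exact integral_const_mul _ _

lemma integral_sq_eval_ne_zero {μ : Measure ℝ} (hmom : ∀ m : ℕ, Integrable (fun x => x ^ m) μ)
    (hsupp : (measSupport μ).Infinite) {f : ℝ[X]} (hf : f ≠ 0) :
    ∫ x, f.eval x ^ 2 ∂μ ≠ 0 := by
  intro h0
  have hint : Integrable (fun x => f.eval x ^ 2) μ :=
    (integrable_polynomial_eval hmom (f ^ 2)).congr (ae_of_all _ fun t => eval_pow 2)
  have hae : ∀ᵐ t ∂μ, f.eval t ^ 2 = 0 :=
    (integral_eq_zero_iff_of_nonneg (fun x => sq_nonneg (f.eval x)) hint).1 h0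
  refine hsupp ((finite_setOfPred_isRoot hf).subset fun x hx => ?_)
  by_contra hroot
  have hopen : IsOpen {t | f.eval t ≠ 0} := isOpen_ne_fun f.continuous continuous_const
  obtain ⟨ε, hε, hball⟩ := Metric.isOpen_iff.1 hopen x hroot
  rw [Real.ball_eq_Ioo] at hball
  refine (hx ε hε).ne' (measure_mono_null hball ?_)
  have hnull : μ {t | ¬ f.eval t ^ 2 = 0} = 0 := ae_iff.1 hae
  simpa using hnull

theorem stmt3 (μ : Measure ℝ) [IsFiniteMeasure μ]
    (hmom : ∀ m : ℕ, Integrable (fun x => x ^ m) μ)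
    (hsupp : (measSupport μ).Infinite)
    (P : ℕ → Polynomial ℝ) (hPm : ∀ m, (P m).Monic) (hPd : ∀ m, (P m).natDegree = m)
    (hPo : ∀ m l, m ≠ l → ∫ x, (P m).eval x * (P l).eval x ∂μ = 0)
    (h : ℕ → ℝ) (hh : ∀ m, h m = ∫ x, ((P m).eval x) ^ 2 ∂μ)
    (n : ℕ) (hn : 1 ≤ n) (k : ℕ) (x y : ℝ) (hxy : x ≠ y) :
    ∑ i ∈ Finset.range n, (P i).eval x * (iterDeriv k (P i)).eval y / h i =
      (Nat.factorial k : ℝ) *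
        ((∑ ν ∈ Finset.range (k + 1),
            (iterDeriv ν (P (n - 1))).eval y * (x - y) ^ ν / Nat.factorial ν) * (P n).eval x -
         (∑ ν ∈ Finset.range (k + 1),
            (iterDeriv ν (P n)).eval y * (x - y) ^ ν / Nat.factorial ν) * (P (n - 1)).eval x) /
        (h (n - 1) * (x - y) ^ (k + 1)) := by
  obtain ⟨n, rfl⟩ : ∃ m, n = m + 1 := ⟨n - 1, by omega⟩
  have h0 : ∀ m, h m ≠ 0 := fun m => by
    rw [hh]
    exact integral_sq_eval_ne_zero hmom hsupp (hPm m).ne_zero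
  have hCD := christoffel_darboux (L := momentFunctional μ hmom) hPm hPd
    (fun m l hml => by simpa [momentFunctional] using hPo m l hml)
    (fun m => by simp [momentFunctional, hh, sq]) h0 n x
  have hT := sum_taylor_C_sub_X_mul
    (∑ i ∈ range (n + 1), C ((P i).eval x / h i) * P i) x y k
  have hsum : (iterDeriv k (∑ i ∈ range (n + 1), C ((P i).eval x / h i) * P i)).eval y =
      ∑ i ∈ range (n + 1), (P i).eval x * (iterDeriv k (P i)).eval y / h i := by
    rw [iterDeriv, iterate_derivative_sum, eval_finsetSum]
    refine sum_congr rfl fun i _ => ?_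
    rw [iterate_derivative_C_mul, eval_mul, eval_C, iterDeriv]
    ring
  have hG : ∀ ν, (iterDeriv ν (C ((P (n + 1)).eval x / h n) * P n -
      C ((P n).eval x / h n) * P (n + 1))).eval y * (x - y) ^ ν / ν.factorial =
      (iterDeriv ν (P n)).eval y * (x - y) ^ ν / ν.factorial * ((P (n + 1)).eval x / h n) -
      (iterDeriv ν (P (n + 1))).eval y * (x - y) ^ ν / ν.factorial * ((P n).eval x / h n) := by
    intro ν
    rw [iterDeriv, iterate_derivative_sub, iterate_derivative_C_mul, iterate_derivative_C_mul]
    simp only [eval_sub, eval_mul, eval_C, iterDeriv]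
    ring
  rw [hCD, hsum, sum_congr rfl fun ν _ => hG ν, sum_sub_distrib, ← sum_mul, ← sum_mul] at hT
  rw [Nat.add_sub_cancel]
  have hxy' : x - y ≠ 0 := sub_ne_zero.2 hxy
  have hk : (k.factorial : ℝ) ≠ 0 := by exact_mod_cast k.factorial_ne_zero
  rw [eq_div_iff (mul_ne_zero (h0 n) (pow_ne_zero _ hxy'))]
  rw [eq_div_iff hk] at hT
  rw [mul_left_comm, ← hT]
  have hn0 := h0 n
  generalize (∑ ν ∈ range (k + 1), (iterDeriv ν (P n)).eval y * (x - y) ^ ν / ν.factorial) = A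
  generalize (∑ ν ∈ range (k + 1),
    (iterDeriv ν (P (n + 1))).eval y * (x - y) ^ ν / ν.factorial) = B
  field_simp
end
end

section
/- Let S be a real polynomial of degree n whose zeros x_1, …, x_n are real and pairwise distinct, and suppose S satisfies A(x) S″(x) + B(x) S′(x) + C(x) S(x) = 0 for real polynomials A, B, C. Then, for every index k with A(x_k) ≠ 0, one has 2 Σ_{i≠k} 1/(x_k − x_i) + B(x_k)/A(x_k) = 0. -/
open Polynomial Finset

theorem eval_derivative_prod_X_sub_C {ι K : Type*} [Field K] (s : Finset ι) (x : ι → K) (a : K)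
    (h : ∀ i ∈ s, a - x i ≠ 0) :
    (Polynomial.derivative (∏ i ∈ s, (X - Polynomial.C (x i)))).eval a =
      (∏ i ∈ s, (a - x i)) * ∑ i ∈ s, 1 / (a - x i) := by
  classical
  rw [derivative_prod_finset, eval_finsetSum, Finset.mul_sum]
  refine Finset.sum_congr rfl fun i hi => ?_
  have hi0 := h i hi
  rw [← Finset.mul_prod_erase s (fun i => a - x i) hi]
  simp only [derivative_X_sub_C, mul_one, eval_prod, eval_sub, eval_X, eval_C]
  field_simp

theorem eval_derivative_X_sub_C_mul {R : Type*} [CommRing R] (a : R) (T : R[X]) :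
    (Polynomial.derivative ((X - Polynomial.C a) * T)).eval a = T.eval a := by
  simp [derivative_mul]

theorem eval_derivative_derivative_X_sub_C_mul {R : Type*} [CommRing R] (a : R) (T : R[X]) :
    (Polynomial.derivative (Polynomial.derivative ((X - Polynomial.C a) * T))).eval a =
      2 * (Polynomial.derivative T).eval a := by
  simp [derivative_mul, two_mul]

theorem stmt17 (n : ℕ) (S A B Q : Polynomial ℝ)
    (hS0 : S ≠ 0) (hSdeg : S.natDegree = n)
    (x : Fin n → ℝ) (hx : Function.Injective x)
    (hS : S = Polynomial.C S.leadingCoeff * ∏ i : Fin n, (X - Polynomial.C (x i)))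
    (hode : A * Polynomial.derivative (Polynomial.derivative S) +
      B * Polynomial.derivative S + Q * S = 0)
    (k : Fin n) (hA : A.eval (x k) ≠ 0) :
    2 * (∑ i ∈ Finset.univ.erase k, 1 / (x k - x i)) + B.eval (x k) / A.eval (x k) = 0 := by
  have hne : ∀ i ∈ Finset.univ.erase k, x k - x i ≠ 0 := fun i hi =>
    sub_ne_zero.mpr fun h => Finset.ne_of_mem_erase hi (hx h).symm
  have hfac : S = (X - Polynomial.C (x k)) * (Polynomial.C S.leadingCoeff *
      ∏ i ∈ Finset.univ.erase k, (X - Polynomial.C (x i))) := by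
    rw [mul_left_comm, Finset.mul_prod_erase Finset.univ
      (fun i => X - Polynomial.C (x i)) (Finset.mem_univ k)]
    exact hS
  have hc : S.leadingCoeff ≠ 0 := leadingCoeff_ne_zero.mpr hS0
  have hP : ∏ i ∈ Finset.univ.erase k, (x k - x i) ≠ 0 := Finset.prod_ne_zero_iff.mpr hne
  generalize S.leadingCoeff = c at hfac hc
  have heval := congrArg (Polynomial.eval (x k)) hode
  rw [hfac] at heval
  simp only [eval_add, eval_mul, eval_derivative_X_sub_C_mul,
    eval_derivative_derivative_X_sub_C_mul, derivative_C_mul, eval_C, eval_sub, eval_X, sub_self,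
    zero_mul, mul_zero, add_zero, eval_zero, eval_prod,
    eval_derivative_prod_X_sub_C _ _ _ hne] at heval
  have hmul : c * (∏ i ∈ Finset.univ.erase k, (x k - x i)) *
      (2 * (∑ i ∈ Finset.univ.erase k, 1 / (x k - x i)) * A.eval (x k) + B.eval (x k)) = 0 := by
    linear_combination heval
  have hsum := (mul_eq_zero.mp hmul).resolve_left (mul_ne_zero hc hP)
  rw [← mul_div_cancel_right₀ (2 * _) hA, ← add_div, hsum, zero_div]
end
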